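/- The DNLS Yang–Baxter map satisfies the parametric Yang–Baxter equation: for all parameters a, b, c ∈ ℂ and all (x,y,z) ∈ (ℂ²)³ such that every denominator arising in both composite maps is nonzero, the two compositions Y¹²_{a,b} ∘ Y¹³_{a,c} ∘ Y²³_{b,c} and Y²³_{b,c} ∘ Y¹³_{a,c} ∘ Y¹²_{a,b} agree at (x,y,z). -/

import Mathlib

/-- First component `u` of the DNLS Yang–Baxter map. -/
noncomputable def dnlsU (a b : ℂ) (x y : ℂ × ℂ) : ℂ × ℂ :=
  (y.1 + ((a - b) / (a - x.1 * y.2)) * x.1,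
   ((a - x.1 * y.2) / (b - x.1 * y.2)) * y.2)

/-- Second component `v` of the DNLS Yang–Baxter map. -/
noncomputable def dnlsV (a b : ℂ) (x y : ℂ × ℂ) : ℂ × ℂ :=
  (((b - x.1 * y.2) / (a - x.1 * y.2)) * x.1,
   x.2 + ((b - a) / (b - x.1 * y.2)) * y.2)

/-- The DNLS Yang–Baxter map satisfies the parametric Yang–Baxter equation
`Y¹²_{a,b} ∘ Y¹³_{a,c} ∘ Y²³_{b,c} = Y²³_{b,c} ∘ Y¹³_{a,c} ∘ Y¹²_{a,b}`,
wherever all the denominators arising in both composite maps are nonzero. -/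
theorem dnls_yang_baxter (a b c : ℂ) (x y z : ℂ × ℂ)
    -- denominators in Y¹²_{a,b} ∘ Y¹³_{a,c} ∘ Y²³_{b,c} (applied right-to-left)
    (h1 : b - y.1 * z.2 ≠ 0) (h1' : c - y.1 * z.2 ≠ 0)
    (h2 : a - x.1 * (dnlsV b c y z).2 ≠ 0) (h2' : c - x.1 * (dnlsV b c y z).2 ≠ 0)
    (h3 : a - (dnlsU a c x (dnlsV b c y z)).1 * (dnlsU b c y z).2 ≠ 0)
    (h3' : b - (dnlsU a c x (dnlsV b c y z)).1 * (dnlsU b c y z).2 ≠ 0)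
    -- denominators in Y²³_{b,c} ∘ Y¹³_{a,c} ∘ Y¹²_{a,b} (applied right-to-left)
    (h4 : a - x.1 * y.2 ≠ 0) (h4' : b - x.1 * y.2 ≠ 0)
    (h5 : a - (dnlsU a b x y).1 * z.2 ≠ 0) (h5' : c - (dnlsU a b x y).1 * z.2 ≠ 0)
    (h6 : b - (dnlsV a b x y).1 * (dnlsV a c (dnlsU a b x y) z).2 ≠ 0)
    (h6' : c - (dnlsV a b x y).1 * (dnlsV a c (dnlsU a b x y) z).2 ≠ 0) :
    (dnlsU a b (dnlsU a c x (dnlsV b c y z)) (dnlsU b c y z),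
     dnlsV a b (dnlsU a c x (dnlsV b c y z)) (dnlsU b c y z),
     dnlsV a c x (dnlsV b c y z))
    =
    (dnlsU a c (dnlsU a b x y) z,
     dnlsU b c (dnlsV a b x y) (dnlsV a c (dnlsU a b x y) z),
     dnlsV b c (dnlsV a b x y) (dnlsV a c (dnlsU a b x y) z)) := by
  obtain ⟨x₁, x₂⟩ := x
  obtain ⟨y₁, y₂⟩ := y
  obtain ⟨z₁, z₂⟩ := z
  simp only [dnlsU, dnlsV] at *
  obtain ⟨Da, hDa⟩ : ∃ D, D = (a - x₁ * y₂) * (c - y₁ * z₂) - (c - b) * (x₁ * z₂) := ⟨_, rfl⟩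
  obtain ⟨Dc, hDc⟩ : ∃ D, D = (c - x₁ * y₂) * (c - y₁ * z₂) - (c - b) * (x₁ * z₂) := ⟨_, rfl⟩
  obtain ⟨Ea, hEa⟩ : ∃ E, E = (a - x₁ * y₂) * (a - y₁ * z₂) - (a - b) * (x₁ * z₂) := ⟨_, rfl⟩
  obtain ⟨Ec, hEc⟩ : ∃ E, E = (a - x₁ * y₂) * (c - y₁ * z₂) - (a - b) * (x₁ * z₂) := ⟨_, rfl⟩
  have e2 : a - x₁ * (y₂ + (c - b) / (c - y₁ * z₂) * z₂) = Da / (c - y₁ * z₂) := by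
    field_simp
    rw [hDa]
    ring
  have e2' : c - x₁ * (y₂ + (c - b) / (c - y₁ * z₂) * z₂) = Dc / (c - y₁ * z₂) := by
    field_simp
    rw [hDc]
    ring
  have e5 : a - (y₁ + (a - b) / (a - x₁ * y₂) * x₁) * z₂ = Ea / (a - x₁ * y₂) := by
    field_simp
    rw [hEa]
    ring
  have e5' : c - (y₁ + (a - b) / (a - x₁ * y₂) * x₁) * z₂ = Ec / (a - x₁ * y₂) := by
    field_simp
    rw [hEc]
    ring
  rw [e2] at h2
  rw [e2'] at h2'
  rw [e5] at h5
  rw [e5'] at h5'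
  have nDa := (div_ne_zero_iff.mp h2).1
  have nDc := (div_ne_zero_iff.mp h2').1
  have nEa := (div_ne_zero_iff.mp h5).1
  have nEc := (div_ne_zero_iff.mp h5').1
  have e3 : a - ((c - y₁ * z₂) / (b - y₁ * z₂) * y₁ + (a - c) / (Da / (c - y₁ * z₂)) * x₁) *
      ((b - y₁ * z₂) / (c - y₁ * z₂) * z₂) = (c - y₁ * z₂) * Ea / Da := by
    field_simp
    rw [hDa, hEa]
    ring
  have e3' : b - ((c - y₁ * z₂) / (b - y₁ * z₂) * y₁ + (a - c) / (Da / (c - y₁ * z₂)) * x₁) *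
      ((b - y₁ * z₂) / (c - y₁ * z₂) * z₂) = (b - y₁ * z₂) * Ec / Da := by
    field_simp
    rw [hDa, hEc]
    ring
  have e6 : b - (b - x₁ * y₂) / (a - x₁ * y₂) * x₁ *
      ((a - x₁ * y₂) / (b - x₁ * y₂) * y₂ + (c - a) / (Ec / (a - x₁ * y₂)) * z₂) =
      (b - x₁ * y₂) * Da / Ec := by
    field_simp
    rw [hDa, hEc]
    ring
  have e6' : c - (b - x₁ * y₂) / (a - x₁ * y₂) * x₁ *
      ((a - x₁ * y₂) / (b - x₁ * y₂) * y₂ + (c - a) / (Ec / (a - x₁ * y₂)) * z₂) =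
      (a - x₁ * y₂) * Dc / Ec := by
    field_simp
    rw [hDc, hEc]
    ring
  simp only [e2, e2', e5, e5', e3, e3', e6, e6', Prod.mk.injEq]
  generalize hA : a - x₁ * y₂ = A at *
  generalize hB : b - x₁ * y₂ = B at *
  generalize hP : b - y₁ * z₂ = P at *
  generalize hQ : c - y₁ * z₂ = Q at *
  refine ⟨⟨?_, ?_⟩, ⟨⟨?_, ?_⟩, ?_, ?_⟩⟩ <;> field_simp <;>
    simp only [hDa, hDc, hEa, hEc, ← hA, ← hB, ← hP, ← hQ] <;> ring
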